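/- Suppose T_1, T_2 are words and 1 ≤ i ≤ n−2 are such that R_1 = T_1·i(i+1)i·T_2 and R_2 = T_1·(i+1)i(i+1)·T_2 are both reduced words for the longest element w_0 ∈ S_n, and set v_1 = Dem(T_1·i·T_2), v_2 = Dem(T_1·(i+1)·T_2). Then for every x ∈ S_n: D_{R_1}(x) − D_{R_2}(x) = 1 if x = v_1, D_{R_1}(x) − D_{R_2}(x) = −1 if x = v_2, and D_{R_1}(x) = D_{R_2}(x) otherwise. -/

import Mathlib

open scoped Classical

namespace BSDist

/-- The simple transposition `s i` (1-indexed): it swaps the values `i` and `i+1`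
of `{1,…,n}`, i.e. the elements `i-1` and `i` of `Fin n`.  Out-of-range letters
give the identity. -/
def sTr (n : ℕ) (i : ℕ) : Equiv.Perm (Fin n) :=
  if h : 1 ≤ i ∧ i < n then Equiv.swap ⟨i - 1, by omega⟩ ⟨i, h.2⟩ else 1

/-- The product `w(R) = s_{i₁} ⋯ s_{i_L}` of a word. -/
def wprod (n : ℕ) (R : List ℕ) : Equiv.Perm (Fin n) := (R.map (sTr n)).prod

/-- The Coxeter length of a permutation: its number of inversions. -/
def len {n : ℕ} (w : Equiv.Perm (Fin n)) : ℕ :=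
  (Finset.univ.filter (fun p : Fin n × Fin n => p.1 < p.2 ∧ w p.2 < w p.1)).card

/-- A word over the alphabet `{1,…,n-1}`. -/
def Alphabet (n : ℕ) (R : List ℕ) : Prop := ∀ i ∈ R, 1 ≤ i ∧ i < n

/-- `R` is a reduced word (over the alphabet `{1,…,n-1}`). -/
def IsReducedWord (n : ℕ) (R : List ℕ) : Prop :=
  Alphabet n R ∧ R.length = len (wprod n R)

/-- `R` is a reduced word for `w`. -/
def IsReducedWordFor (n : ℕ) (R : List ℕ) (w : Equiv.Perm (Fin n)) : Prop :=
  IsReducedWord n R ∧ wprod n R = w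

/-- The weight `wt_R : S_n → ℤ[q]`, defined by the recursion
`wt_∅(e) = 1`, `wt_∅(x) = 0` for `x ≠ e`, and for an appended letter `i`:
`wt_{Ri}(x) = wt_R(x) + wt_R(x sᵢ)` if `ℓ(x sᵢ) > ℓ(x)`, and
`wt_{Ri}(x) = q·wt_R(x) + q·wt_R(x sᵢ)` if `ℓ(x sᵢ) < ℓ(x)`. -/
noncomputable def wt (n : ℕ) (R : List ℕ) : Equiv.Perm (Fin n) → Polynomial ℤ :=
  R.foldl
    (fun f i x =>
      if len x < len (x * sTr n i) then f x + f (x * sTr n i)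
      else Polynomial.X * f x + Polynomial.X * f (x * sTr n i))
    (fun x => if x = 1 then 1 else 0)

/-- A single commutation move: replace a consecutive factor `ij` by `ji` where
`|i - j| > 1`. -/
def CommMove (R R' : List ℕ) : Prop :=
  ∃ (A B : List ℕ) (i j : ℕ), (i + 1 < j ∨ j + 1 < i) ∧
    R = A ++ [i, j] ++ B ∧ R' = A ++ [j, i] ++ B

/-- Commutation equivalence: a finite sequence of commutation moves. -/
def CommEquiv (R R' : List ℕ) : Prop := Relation.ReflTransGen CommMove R R'

/-- A single braid move: replace a consecutive factor `k(k+1)k` by `(k+1)k(k+1)`. -/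
def BraidMove (R R' : List ℕ) : Prop :=
  ∃ (A B : List ℕ) (k : ℕ),
    R = A ++ [k, k + 1, k] ++ B ∧ R' = A ++ [k + 1, k, k + 1] ++ B

/-- The Demazure product of a word, computed left to right:
`w ∗ sᵢ = w sᵢ` if `ℓ(w sᵢ) > ℓ(w)`, and `w ∗ sᵢ = w` otherwise. -/
def dem (n : ℕ) (R : List ℕ) : Equiv.Perm (Fin n) :=
  R.foldl (fun w i => if len w < len (w * sTr n i) then w * sTr n i else w) 1

/-- `app w t` is the value `w(t)` in 1-indexed one-line notation:
positions and values both run through `{1,…,n}`. -/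
def app {n : ℕ} (w : Equiv.Perm (Fin n)) (t : ℕ) : ℕ :=
  if h : 1 ≤ t ∧ t ≤ n then ((w ⟨t - 1, by omega⟩ : Fin n) : ℕ) + 1 else 0

/-- `posOf x t = x⁻¹(t)`, the (1-indexed) position of the value `t` in `x`. -/
def posOf {n : ℕ} (x : Equiv.Perm (Fin n)) (t : ℕ) : ℕ := app x⁻¹ t

/-- The longest element `w₀` of `S_n` (the order-reversing permutation). -/
def w0 (n : ℕ) : Equiv.Perm (Fin n) := ⟨Fin.rev, Fin.rev, Fin.rev_rev, Fin.rev_rev⟩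

/-- The value pair `(a,b)` (with `a < b`) is an inversion of `x`:
`x⁻¹(a) > x⁻¹(b)`. -/
def IsInversion {n : ℕ} (x : Equiv.Perm (Fin n)) (a b : ℕ) : Prop :=
  posOf x b < posOf x a

/-- `tau R a b` is the first time `k` at which the pair `(a,b)` is an inversion
of the prefix product `s_{i₁} ⋯ s_{i_k}`. -/
noncomputable def tau (n : ℕ) (R : List ℕ) (a b : ℕ) : ℕ :=
  sInf {k | IsInversion (wprod n (R.take k)) a b}

/-- `T_R(a,b,c) = +1` if `τ_R(a,b) < τ_R(b,c)` and `-1` otherwise. -/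
noncomputable def T (n : ℕ) (R : List ℕ) (a b c : ℕ) : ℤ :=
  if tau n R a b < tau n R b c then 1 else -1

/-- `Supp(x) = {t : pos_x(t) ≠ pos_{w₀}(t)}`. -/
noncomputable def Supp (n : ℕ) (x : Equiv.Perm (Fin n)) : Finset ℕ :=
  (Finset.Icc 1 n).filter (fun t => posOf x t ≠ posOf (w0 n) t)

/-- `Fwd(x) = {t : pos_x(t) < pos_{w₀}(t)}`. -/
noncomputable def Fwd (n : ℕ) (x : Equiv.Perm (Fin n)) : Finset ℕ :=
  (Finset.Icc 1 n).filter (fun t => posOf x t < posOf (w0 n) t)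

/-- `Bwd(x) = {t : pos_x(t) > pos_{w₀}(t)}`. -/
noncomputable def Bwd (n : ℕ) (x : Equiv.Perm (Fin n)) : Finset ℕ :=
  (Finset.Icc 1 n).filter (fun t => posOf (w0 n) t < posOf x t)

/-- `D_R(x)`: the coefficient of `q^{N-1}` in `wt_R(x)`, where `N = n(n-1)/2`. -/
noncomputable def D (n : ℕ) (R : List ℕ) (x : Equiv.Perm (Fin n)) : ℤ :=
  (wt n R x).coeff (n * (n - 1) / 2 - 1)

/-- `σ_b(x) = sign(pos_x(b) − pos_{w₀}(b)) ∈ {−1,0,+1}`. -/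
noncomputable def sigmaVal (n : ℕ) (b : ℕ) (x : Equiv.Perm (Fin n)) : ℤ :=
  Int.sign ((posOf x b : ℤ) - (posOf (w0 n) b : ℤ))

/-- `Θ_R(a,b,c) = Σ_{x : Supp(x) = [a,c]} D_R(x)·σ_b(x)`. -/
noncomputable def Theta (n : ℕ) (R : List ℕ) (a b c : ℕ) : ℤ :=
  ∑ x ∈ Finset.univ.filter (fun x : Equiv.Perm (Fin n) => Supp n x = Finset.Icc a c),
    D n R x * sigmaVal n b x

end BSDist

namespace BSDist

/-! ### Helper lemmas -/

lemma sTr_eq (n j : ℕ) (hj : 1 ≤ j ∧ j < n) :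
    ∃ a b : Fin n, a.val + 1 = j ∧ b.val = j ∧ sTr n j = Equiv.swap a b := by
  refine ⟨⟨j - 1, by omega⟩, ⟨j, hj.2⟩, by simp; omega, rfl, ?_⟩
  simp [sTr, hj]

lemma swap_lt {n : ℕ} (a b : Fin n) (hab : b.val = a.val + 1) (x y : Fin n)
    (hxy : x < y) (hne : ¬ (x = a ∧ y = b)) : Equiv.swap a b x < Equiv.swap a b y := by
  rw [Equiv.swap_apply_def, Equiv.swap_apply_def]
  split_ifs <;> simp only [Fin.ext_iff, Fin.lt_def] at * <;> omega

lemma len_asc {n : ℕ} (w : Equiv.Perm (Fin n)) (a b : Fin n) (hab : b.val = a.val + 1)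
    (h : w a < w b) : len (w * Equiv.swap a b) = len w + 1 := by
  unfold len
  have hlt : a < b := by rw [Fin.lt_def]; omega
  set I := Finset.univ.filter (fun p : Fin n × Fin n => p.1 < p.2 ∧ w p.2 < w p.1) with hI
  have hnot : (a, b) ∉ I.map ((Equiv.prodCongr (Equiv.swap a b) (Equiv.swap a b)).toEmbedding) := by
    simp only [Finset.mem_map, hI, Finset.mem_filter, Finset.mem_univ, true_and]
    rintro ⟨⟨x, y⟩, ⟨h1, h2⟩, h3⟩
    simp only [Equiv.coe_toEmbedding, Equiv.prodCongr_apply, Prod.map_apply, Prod.mk.injEq] at h3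
    have hx : x = b := by
      have := congrArg (Equiv.swap a b) h3.1
      simpa using this
    have hy : y = a := by
      have := congrArg (Equiv.swap a b) h3.2
      simpa using this
    subst hx hy
    exact absurd h1 (not_lt.mpr hlt.le)
  rw [← Finset.card_map (s := I) ((Equiv.prodCongr (Equiv.swap a b) (Equiv.swap a b)).toEmbedding),
    ← Finset.card_insert_of_notMem hnot]
  congr 1
  ext ⟨x, y⟩
  simp only [Finset.mem_filter, Finset.mem_univ, true_and, Finset.mem_insert, Finset.mem_map,
    hI]
  rw [Equiv.Perm.mul_apply, Equiv.Perm.mul_apply]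
  constructor
  · rintro ⟨h1, h2⟩
    by_cases hc : x = a ∧ y = b
    · left; rw [hc.1, hc.2]
    · right
      refine ⟨(Equiv.swap a b x, Equiv.swap a b y), ⟨swap_lt a b hab x y h1 hc, h2⟩, ?_⟩
      simp
  · rintro (h1 | ⟨⟨x', y'⟩, ⟨h1, h2⟩, h3⟩)
    · obtain ⟨rfl, rfl⟩ := Prod.mk.inj h1
      simp [hlt, h]
    · simp only [Equiv.coe_toEmbedding, Equiv.prodCongr_apply, Prod.map_apply,
        Prod.mk.injEq] at h3
      obtain ⟨rfl, rfl⟩ := h3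
      refine ⟨swap_lt a b hab x' y' h1 ?_, by simpa using h2⟩
      rintro ⟨rfl, rfl⟩
      exact absurd h2 (not_lt.mpr h.le)

lemma len_desc {n : ℕ} (w : Equiv.Perm (Fin n)) (a b : Fin n) (hab : b.val = a.val + 1)
    (h : w b < w a) : len (w * Equiv.swap a b) + 1 = len w := by
  have := len_asc (w * Equiv.swap a b) a b hab (by simpa using h)
  rw [mul_assoc, Equiv.swap_mul_self, mul_one] at this
  exact this.symm

lemma asc_iff {n : ℕ} (w : Equiv.Perm (Fin n)) (a b : Fin n) (hab : b.val = a.val + 1) :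
    len w < len (w * Equiv.swap a b) ↔ w a < w b := by
  have hne : w a ≠ w b := fun h => by
    have := w.injective h
    rw [Fin.ext_iff] at this; omega
  rcases lt_or_gt_of_ne hne with h | h
  · rw [len_asc w a b hab h]; simp [h]
  · have := len_desc w a b hab h
    constructor
    · intro; omega
    · intro h'; exact absurd h (not_lt.mpr h'.le)

lemma len_step_le {n : ℕ} (w : Equiv.Perm (Fin n)) (j : ℕ) (hj : 1 ≤ j ∧ j < n) :
    len (w * sTr n j) ≤ len w + 1 := by
  obtain ⟨a, b, ha, hb, hs⟩ := sTr_eq n j hj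
  have hab : b.val = a.val + 1 := by omega
  rw [hs]
  by_cases h : len w < len (w * Equiv.swap a b)
  · rw [len_asc w a b hab ((asc_iff w a b hab).1 h)]
  · omega

lemma sTr_mul_self (n j : ℕ) : sTr n j * sTr n j = 1 := by
  unfold sTr; split_ifs <;> simp

lemma asc_flip {n : ℕ} (w : Equiv.Perm (Fin n)) (j : ℕ) (hj : 1 ≤ j ∧ j < n) :
    len (w * sTr n j) < len (w * sTr n j * sTr n j) ↔ ¬ len w < len (w * sTr n j) := by
  obtain ⟨a, b, ha, hb, hs⟩ := sTr_eq n j hj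
  have hab : b.val = a.val + 1 := by omega
  have hne : w a ≠ w b := fun h => by
    have := w.injective h
    rw [Fin.ext_iff] at this; omega
  rw [hs, asc_iff _ a b hab, asc_iff _ a b hab]
  simp only [Equiv.Perm.mul_apply, Equiv.swap_apply_left, Equiv.swap_apply_right, not_lt]
  exact ⟨le_of_lt, fun h => lt_of_le_of_ne h (Ne.symm hne)⟩

lemma len_wprod_le {n : ℕ} (R : List ℕ) : ∀ (w : Equiv.Perm (Fin n)), Alphabet n R →
    len (w * wprod n R) ≤ len w + R.length := by
  induction R with
  | nil => intro w _; simp [wprod]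
  | cons j R ih =>
    intro w h
    have h1 := ih (w * sTr n j) (fun k hk => h k (List.mem_cons_of_mem _ hk))
    have h2 := len_step_le w j (h j List.mem_cons_self)
    have : w * wprod n (j :: R) = w * sTr n j * wprod n R := by simp [wprod, mul_assoc]
    rw [this, List.length_cons]; omega

lemma wprod_append (n : ℕ) (A B : List ℕ) : wprod n (A ++ B) = wprod n A * wprod n B := by
  simp [wprod]

/-- `w · R` is length additive. -/
def Add {n : ℕ} (w : Equiv.Perm (Fin n)) (R : List ℕ) : Prop :=
  Alphabet n R ∧ len (w * wprod n R) = len w + R.length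

lemma Add.split {n : ℕ} {w : Equiv.Perm (Fin n)} {A B : List ℕ} (h : Add w (A ++ B)) :
    Add w A ∧ Add (w * wprod n A) B := by
  obtain ⟨h1, h2⟩ := h
  have hA : Alphabet n A := fun k hk => h1 k (List.mem_append_left _ hk)
  have hB : Alphabet n B := fun k hk => h1 k (List.mem_append_right _ hk)
  have h3 := len_wprod_le A w hA
  have h4 := len_wprod_le B (w * wprod n A) hB
  rw [wprod_append, ← mul_assoc, List.length_append] at h2
  exact ⟨⟨hA, by omega⟩, ⟨hB, by omega⟩⟩

lemma Add.cons {n : ℕ} {w : Equiv.Perm (Fin n)} {j : ℕ} {B : List ℕ} (h : Add w (j :: B)) :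
    (1 ≤ j ∧ j < n) ∧ len w < len (w * sTr n j) ∧ Add (w * sTr n j) B := by
  have := Add.split (A := [j]) h
  obtain ⟨⟨h1, h2⟩, h3⟩ := this
  simp only [wprod, List.map_cons, List.map_nil, List.prod_cons, List.prod_nil, mul_one,
    List.length_singleton] at h2
  refine ⟨h1 j (by simp), by omega, ?_⟩
  simpa [wprod] using h3

/-- One step of the Demazure product. -/
noncomputable def demStep (n : ℕ) (w : Equiv.Perm (Fin n)) (i : ℕ) : Equiv.Perm (Fin n) :=
  if len w < len (w * sTr n i) then w * sTr n i else w

lemma dem_eq (n : ℕ) (R : List ℕ) : dem n R = R.foldl (demStep n) 1 := rfl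

lemma dem_of_add {n : ℕ} (R : List ℕ) : ∀ (w : Equiv.Perm (Fin n)), Add w R →
    R.foldl (demStep n) w = w * wprod n R := by
  induction R with
  | nil => intro w _; simp [wprod]
  | cons j R ih =>
    intro w h
    obtain ⟨_, h2, h3⟩ := h.cons
    rw [List.foldl_cons, demStep, if_pos h2, ih _ h3]
    simp [wprod, mul_assoc]

/-- Coupling invariant for the first Demazure run. -/
def Inv1 {n : ℕ} (c : Fin n) (π ρ : Equiv.Perm (Fin n)) : Prop :=
  ∃ p r q : Fin n, p < r ∧ r < q ∧ π r = c ∧ ρ p = c ∧ c < π p ∧ π q < c ∧ ρ r < c ∧ c < ρ q ∧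
    ∀ x, x ≠ p → x ≠ r → x ≠ q → (π x < c ↔ ρ x < c)

/-- Coupling invariant for the second Demazure run. -/
def Inv2 {n : ℕ} (c : Fin n) (π ρ : Equiv.Perm (Fin n)) : Prop :=
  ∃ p r q : Fin n, p < r ∧ r < q ∧ π r = c ∧ ρ q = c ∧ c < π p ∧ π q < c ∧ ρ p < c ∧ c < ρ r ∧
    ∀ x, x ≠ p → x ≠ r → x ≠ q → (π x < c ↔ ρ x < c)

/-- One step of the weight recursion. -/
noncomputable def wtStep (n : ℕ) (f : Equiv.Perm (Fin n) → Polynomial ℤ) (i : ℕ) :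
    Equiv.Perm (Fin n) → Polynomial ℤ := fun x =>
  if len x < len (x * sTr n i) then f x + f (x * sTr n i)
  else Polynomial.X * f x + Polynomial.X * f (x * sTr n i)

lemma wt_eq (n : ℕ) (R : List ℕ) :
    wt n R = R.foldl (wtStep n) (fun x => if x = 1 then 1 else 0) := rfl

lemma wt_top {n : ℕ} (R : List ℕ) : ∀ (f : Equiv.Perm (Fin n) → Polynomial ℤ)
    (d : Equiv.Perm (Fin n)) (L : ℕ), Alphabet n R →
    (∀ x k, L < k → (f x).coeff k = 0) → (∀ x, (f x).coeff L = if x = d then 1 else 0) →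
    ∀ x, (R.foldl (wtStep n) f x).coeff (L + R.length) =
      if x = R.foldl (demStep n) d then 1 else 0 := by
  induction R with
  | nil => intro f d L _ _ h2 x; exact h2 x
  | cons j R ih =>
    intro f d L hA h1 h2 x
    have hj := hA j List.mem_cons_self
    rw [List.foldl_cons, List.foldl_cons, List.length_cons,
      show L + (R.length + 1) = (L + 1) + R.length by omega]
    apply ih _ _ _ (fun k hk => hA k (List.mem_cons_of_mem _ hk))
    · intro x k hk
      obtain ⟨k, rfl⟩ : ∃ m, k = m + 1 := ⟨k - 1, by omega⟩
      unfold wtStep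
      split_ifs
      · rw [Polynomial.coeff_add, h1 _ _ (by omega), h1 _ _ (by omega), add_zero]
      · rw [Polynomial.coeff_add, Polynomial.coeff_X_mul, Polynomial.coeff_X_mul,
          h1 _ _ (by omega), h1 _ _ (by omega), add_zero]
    · intro x
      have hss : ∀ y, y * sTr n j * sTr n j = y := fun y => by
        rw [mul_assoc, sTr_mul_self, mul_one]
      have hfl := asc_flip d j hj
      have hflx := asc_flip x j hj
      unfold wtStep demStep
      by_cases hx : len x < len (x * sTr n j)
      · rw [if_pos hx, Polynomial.coeff_add, h1 _ _ (by omega), h1 _ _ (by omega), add_zero]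
        rw [if_neg]
        split_ifs with hd
        · rintro rfl; exact absurd hd (hfl.1 hx)
        · rintro rfl; exact hd hx
      · rw [if_neg hx, Polynomial.coeff_add, Polynomial.coeff_X_mul, Polynomial.coeff_X_mul,
          h2, h2]
        by_cases hd : len d < len (d * sTr n j)
        · rw [if_pos hd, if_neg (show x ≠ d by rintro rfl; exact hx hd), zero_add]
          have : (x * sTr n j = d) ↔ (x = d * sTr n j) :=
            ⟨fun h => by rw [← h, hss], fun h => by rw [h, hss]⟩
          simp only [this]
        · rw [if_neg hd, if_neg (show x * sTr n j ≠ d by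
            intro h; rw [← h] at hd; exact hd (hflx.2 hx)), add_zero]

lemma wt_diff {n : ℕ} (R : List ℕ) : ∀ (f₁ f₂ g₁ g₂ : Equiv.Perm (Fin n) → Polynomial ℤ),
    (∀ x, f₁ x - f₂ x = Polynomial.X * (g₁ x - g₂ x)) →
    ∀ x, R.foldl (wtStep n) f₁ x - R.foldl (wtStep n) f₂ x =
      Polynomial.X * (R.foldl (wtStep n) g₁ x - R.foldl (wtStep n) g₂ x) := by
  induction R with
  | nil => intro f₁ f₂ g₁ g₂ h x; simpa using h x
  | cons j R ih =>
    intro f₁ f₂ g₁ g₂ h x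
    simp only [List.foldl_cons]
    apply ih
    intro y
    have h1 := h y
    have h2 := h (y * sTr n j)
    unfold wtStep
    split_ifs
    · linear_combination h1 + h2
    · linear_combination Polynomial.X * h1 + Polynomial.X * h2

lemma len_w0 (n : ℕ) : len (w0 n) = n * (n - 1) / 2 := by
  have h : len (w0 n) = ∑ a : Fin n, (n - 1 - (a : ℕ)) := by
    unfold len
    rw [Finset.card_filter, Fintype.sum_prod_type]
    apply Finset.sum_congr rfl
    intro a _
    rw [← Fin.card_Ioi a, ← Finset.card_filter]
    congr 1
    ext b
    simp [w0]
  rw [h, Fin.sum_univ_eq_sum_range (fun k => n - 1 - k) n, Finset.sum_range_reflect (fun k => k) n,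
    Finset.sum_range_id]

lemma braid_step {n : ℕ} (i : ℕ) (hi : 1 ≤ i ∧ i + 1 < n)
    (f : Equiv.Perm (Fin n) → Polynomial ℤ) (x : Equiv.Perm (Fin n)) :
    [i, i + 1, i].foldl (wtStep n) f x - [i + 1, i, i + 1].foldl (wtStep n) f x =
      Polynomial.X * ([i].foldl (wtStep n) f x - [i + 1].foldl (wtStep n) f x) := by
  obtain ⟨a, b, ha, hb, hs⟩ := sTr_eq n i (by omega)
  obtain ⟨b', c, hb', hc, ht⟩ := sTr_eq n (i + 1) (by omega)
  obtain rfl : b = b' := Fin.ext (by omega)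
  have hab : b.val = a.val + 1 := by omega
  have hbc : c.val = b.val + 1 := by omega
  have nab : a ≠ b := by rw [Ne, Fin.ext_iff]; omega
  have nbc : b ≠ c := by rw [Ne, Fin.ext_iff]; omega
  have nac : a ≠ c := by rw [Ne, Fin.ext_iff]; omega
  have hA : ∀ w : Equiv.Perm (Fin n), (len w < len (w * Equiv.swap a b) ↔ w a < w b) :=
    fun w => asc_iff w a b hab
  have hB : ∀ w : Equiv.Perm (Fin n), (len w < len (w * Equiv.swap b c) ↔ w b < w c) :=
    fun w => asc_iff w b c hbc
  have e1 : Equiv.swap a b c = c := Equiv.swap_apply_of_ne_of_ne nac.symm nbc.symm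
  have e2 : Equiv.swap b c a = a := Equiv.swap_apply_of_ne_of_ne nab nac
  have hbr : ∀ w : Equiv.Perm (Fin n),
      w * Equiv.swap b c * Equiv.swap a b * Equiv.swap b c =
      w * Equiv.swap a b * Equiv.swap b c * Equiv.swap a b := by
    intro w
    simp only [mul_assoc]
    congr 1
    rw [← mul_assoc, ← mul_assoc]
    rw [Equiv.swap_mul_swap_mul_swap nab nac, Equiv.swap_comm a b, Equiv.swap_comm b c,
      Equiv.swap_mul_swap_mul_swap nbc.symm nac.symm, Equiv.swap_comm]
  simp only [List.foldl_cons, List.foldl_nil, wtStep, hs, ht, hA, hB]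
  simp only [Equiv.Perm.mul_apply,
    Equiv.swap_apply_left, Equiv.swap_apply_right, e1, e2, hbr, Equiv.mul_swap_mul_self]
  have n1 : x a ≠ x b := fun h => nab (x.injective h)
  have n2 : x b ≠ x c := fun h => nbc (x.injective h)
  have n3 : x a ≠ x c := fun h => nac (x.injective h)
  rcases lt_or_gt_of_ne n1 with h1 | h1 <;> rcases lt_or_gt_of_ne n2 with h2 | h2 <;>
    rcases lt_or_gt_of_ne n3 with h3 | h3 <;>
    first
    | exact absurd (h1.trans h2) (not_lt.mpr h3.le)
    | exact absurd (h2.trans h1) (not_lt.mpr h3.le)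
    | (simp only [h1, h2, h3, not_lt.mpr h1.le, not_lt.mpr h2.le, not_lt.mpr h3.le, if_true,
        if_false]
       ring)

lemma inv_tables {n : ℕ} (π ρ : Equiv.Perm (Fin n)) (j : ℕ) (hj : 1 ≤ j ∧ j < n)
    (h : len π < len (π * sTr n j)) :
    ∃ a b : Fin n, b.val = a.val + 1 ∧ π a < π b ∧
      (π * sTr n j) a = π b ∧ (π * sTr n j) b = π a ∧
      (∀ x, x ≠ a → x ≠ b → (π * sTr n j) x = π x) ∧
      (ρ a < ρ b → demStep n ρ j a = ρ b ∧ demStep n ρ j b = ρ a) ∧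
      (¬ ρ a < ρ b → demStep n ρ j a = ρ a ∧ demStep n ρ j b = ρ b) ∧
      (∀ x, x ≠ a → x ≠ b → demStep n ρ j x = ρ x) := by
  obtain ⟨a, b, ha, hb, hs⟩ := sTr_eq n j hj
  have hab : b.val = a.val + 1 := by omega
  rw [hs, asc_iff _ a b hab] at h
  refine ⟨a, b, hab, h, ?_, ?_, ?_, ?_, ?_, ?_⟩
  · simp [hs]
  · simp [hs]
  · intro x h1 h2; simp [hs, Equiv.swap_apply_of_ne_of_ne h1 h2]
  · intro h1; simp [demStep, hs, asc_iff _ a b hab, h1]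
  · intro h1; simp [demStep, hs, asc_iff _ a b hab, h1]
  · intro x h1 h2
    simp only [demStep, hs, asc_iff _ a b hab]
    split_ifs <;> simp [Equiv.swap_apply_of_ne_of_ne h1 h2]

lemma Inv1.step {n : ℕ} {c : Fin n} {π ρ : Equiv.Perm (Fin n)} (H : Inv1 c π ρ) (j : ℕ)
    (hj : 1 ≤ j ∧ j < n) (h : len π < len (π * sTr n j)) :
    Inv1 c (π * sTr n j) (demStep n ρ j) := by
  obtain ⟨a, b, hab, hlt, t1, t2, t3, t4, t5, t6⟩ := inv_tables π ρ j hj h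
  obtain ⟨p, r, q, hpr, hrq, h1, h2, h3, h4, h5, h6, h7⟩ := H
  have hπ : ∀ x, x ≠ r → π x ≠ c := fun x hx he => hx (π.injective (he.trans h1.symm))
  have hρ : ∀ x, x ≠ p → ρ x ≠ c := fun x hx he => hx (ρ.injective (he.trans h2.symm))
  generalize π * sTr n j = π' at *
  generalize demStep n ρ j = ρ' at *
  refine ⟨if a = p then b else if b = p ∧ π a < c then a else p,
    if a = r then b else if b = r then a else r,
    if b = q then a else if a = q ∧ c < π b then b else q, ?_⟩
  refine ⟨by grind, by grind, by grind, by grind, by grind, by grind, by grind, by grind, ?_⟩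
  intro x x1 x2 x3
  by_cases xa : x = a
  · subst xa
    clear t3 t6
    by_cases hh : ρ x < ρ b
    · have := t4 hh
      clear t4 t5
      grind
    · have := t5 hh
      clear t4 t5
      grind
  by_cases xb : x = b
  · subst xb
    clear t3 t6
    by_cases hh : ρ a < ρ x
    · have := t4 hh
      clear t4 t5
      grind
    · have := t5 hh
      clear t4 t5
      grind
  rw [t3 x xa xb, t6 x xa xb]
  apply h7
  · clear t3 t6 h7; grind
  · clear t3 t6 h7; grind
  · clear t3 t6 h7; grind

lemma Inv2.step {n : ℕ} {c : Fin n} {π ρ : Equiv.Perm (Fin n)} (H : Inv2 c π ρ) (j : ℕ)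
    (hj : 1 ≤ j ∧ j < n) (h : len π < len (π * sTr n j)) :
    Inv2 c (π * sTr n j) (demStep n ρ j) := by
  obtain ⟨a, b, hab, hlt, t1, t2, t3, t4, t5, t6⟩ := inv_tables π ρ j hj h
  obtain ⟨p, r, q, hpr, hrq, h1, h2, h3, h4, h5, h6, h7⟩ := H
  have hπ : ∀ x, x ≠ r → π x ≠ c := fun x hx he => hx (π.injective (he.trans h1.symm))
  have hρ : ∀ x, x ≠ q → ρ x ≠ c := fun x hx he => hx (ρ.injective (he.trans h2.symm))
  generalize π * sTr n j = π' at *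
  generalize demStep n ρ j = ρ' at *
  refine ⟨if a = p then b else if b = p ∧ π a < c then a else p,
    if a = r then b else if b = r then a else r,
    if b = q then a else if a = q ∧ c < π b then b else q, ?_⟩
  refine ⟨by grind, by grind, by grind, by grind, by grind, by grind, by grind, by grind, ?_⟩
  intro x x1 x2 x3
  by_cases xa : x = a
  · subst xa
    clear t3 t6
    by_cases hh : ρ x < ρ b
    · have := t4 hh
      clear t4 t5
      grind
    · have := t5 hh
      clear t4 t5
      grind
  by_cases xb : x = b
  · subst xb
    clear t3 t6
    by_cases hh : ρ a < ρ x
    · have := t4 hh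
      clear t4 t5
      grind
    · have := t5 hh
      clear t4 t5
      grind
  rw [t3 x xa xb, t6 x xa xb]
  apply h7
  · clear t3 t6 h7; grind
  · clear t3 t6 h7; grind
  · clear t3 t6 h7; grind

lemma inv_run {n : ℕ} (I : Equiv.Perm (Fin n) → Equiv.Perm (Fin n) → Prop)
    (hI : ∀ π ρ j, I π ρ → 1 ≤ j ∧ j < n → len π < len (π * sTr n j) →
      I (π * sTr n j) (demStep n ρ j)) (R : List ℕ) :
    ∀ π ρ, I π ρ → Add π R → I (π * wprod n R) (R.foldl (demStep n) ρ) := by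
  induction R with
  | nil => intro π ρ h _; simpa [wprod] using h
  | cons j R ih =>
    intro π ρ h hadd
    obtain ⟨h1, h2, h3⟩ := hadd.cons
    have := ih _ _ (hI π ρ j h h1 h2) h3
    simpa [wprod, mul_assoc] using this

lemma v_ne {n : ℕ} (T₁ T₂ : List ℕ) (i : ℕ) (hi : 1 ≤ i ∧ i + 1 < n)
    (hred : IsReducedWordFor n (T₁ ++ [i, i + 1, i] ++ T₂) (w0 n)) :
    dem n (T₁ ++ [i] ++ T₂) ≠ dem n (T₁ ++ [i + 1] ++ T₂) := by
  obtain ⟨⟨hA, hlen⟩, -⟩ := hred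
  have hadd : Add (1 : Equiv.Perm (Fin n)) (T₁ ++ [i, i + 1, i] ++ T₂) := by
    refine ⟨hA, ?_⟩
    have : len (1 : Equiv.Perm (Fin n)) = 0 := by
      unfold len
      rw [Finset.card_eq_zero, Finset.filter_eq_empty_iff]
      rintro x _ ⟨h1, h2⟩
      exact absurd h1 (not_lt.mpr h2.le)
    rw [this, one_mul, zero_add, hlen]
  rw [List.append_assoc] at hadd
  obtain ⟨hT, hadd⟩ := hadd.split
  obtain ⟨-, k1, hadd⟩ := hadd.cons
  obtain ⟨-, k2, hadd⟩ := hadd.cons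
  obtain ⟨-, k3, hadd⟩ := hadd.cons
  change Add _ T₂ at hadd
  have hd := dem_of_add T₁ 1 hT
  set u := 1 * wprod n T₁ with hu
  obtain ⟨a, b, ha, hb, hs⟩ := sTr_eq n i (by omega)
  obtain ⟨b', c, hb', hc, ht⟩ := sTr_eq n (i + 1) (by omega)
  obtain rfl : b = b' := Fin.ext (by omega)
  have hab : b.val = a.val + 1 := by omega
  have hbc : c.val = b.val + 1 := by omega
  have nab : a ≠ b := by rw [Ne, Fin.ext_iff]; omega
  have nbc : b ≠ c := by rw [Ne, Fin.ext_iff]; omega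
  have nac : a ≠ c := by rw [Ne, Fin.ext_iff]; omega
  have e1 : Equiv.swap a b c = c := Equiv.swap_apply_of_ne_of_ne nac.symm nbc.symm
  have e2 : Equiv.swap b c a = a := Equiv.swap_apply_of_ne_of_ne nab nac
  have k1' := k1
  rw [hs, asc_iff _ a b hab] at k1
  rw [hs, ht, asc_iff _ b c hbc] at k2
  rw [hs, ht, asc_iff _ a b hab] at k3
  simp only [Equiv.Perm.mul_apply, Equiv.swap_apply_left, Equiv.swap_apply_right, e1, e2]
    at k1 k2 k3
  have lab : a < b := by rw [Fin.lt_def]; omega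
  have lbc : b < c := by rw [Fin.lt_def]; omega
  have g1 : Inv1 (u b) (u * sTr n i * sTr n (i + 1) * sTr n i) (demStep n u i) := by
    rw [demStep, if_pos k1', hs, ht]
    refine ⟨a, b, c, lab, lbc, ?_⟩
    simp only [Equiv.Perm.mul_apply, Equiv.swap_apply_left, Equiv.swap_apply_right, e1, e2]
    refine ⟨trivial, trivial, k3, k1, k1, k3, fun x h1 h2 h3 => ?_⟩
    simp [Equiv.swap_apply_of_ne_of_ne h1 h2, Equiv.swap_apply_of_ne_of_ne h2 h3]
  have g2 : Inv2 (u b) (u * sTr n i * sTr n (i + 1) * sTr n i) (demStep n u (i + 1)) := by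
    rw [demStep, hs, ht, if_pos ((asc_iff _ b c hbc).2 k3)]
    refine ⟨a, b, c, lab, lbc, ?_⟩
    simp only [Equiv.Perm.mul_apply, Equiv.swap_apply_left, Equiv.swap_apply_right, e1, e2]
    refine ⟨trivial, trivial, k3, k1, k1, k3, fun x h1 h2 h3 => ?_⟩
    simp [Equiv.swap_apply_of_ne_of_ne h1 h2, Equiv.swap_apply_of_ne_of_ne h2 h3]
  have f1 := inv_run (Inv1 (u b)) (fun π ρ j H => H.step j) T₂ _ _ g1 hadd
  have f2 := inv_run (Inv2 (u b)) (fun π ρ j H => H.step j) T₂ _ _ g2 hadd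
  intro heq
  have q1 : dem n (T₁ ++ [i] ++ T₂) = T₂.foldl (demStep n) (demStep n u i) := by
    rw [dem_eq, List.foldl_append, List.foldl_append, hd]; rfl
  have q2 : dem n (T₁ ++ [i + 1] ++ T₂) = T₂.foldl (demStep n) (demStep n u (i + 1)) := by
    rw [dem_eq, List.foldl_append, List.foldl_append, hd]; rfl
  rw [← q1, heq] at f1
  rw [← q2] at f2
  obtain ⟨p, r, q, hpr, -, hr, hp, -⟩ := f1
  obtain ⟨p', r', q', -, hrq', hr', hq', -⟩ := f2
  have z1 : r = r' := Equiv.injective _ (hr.trans hr'.symm)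
  have z2 : p = q' := Equiv.injective _ (hp.trans hq'.symm)
  subst z1 z2
  exact absurd hpr (not_lt.mpr hrq'.le)

/-- Suppose `R₁ = T₁·i(i+1)i·T₂` and
`R₂ = T₁·(i+1)i(i+1)·T₂` are both reduced words for `w₀ ∈ S_n`, and
`v₁ = Dem(T₁·i·T₂)`, `v₂ = Dem(T₁·(i+1)·T₂)`.  Then
`D_{R₁}(v₁) − D_{R₂}(v₁) = 1`, `D_{R₁}(v₂) − D_{R₂}(v₂) = −1`, and
`D_{R₁}(x) = D_{R₂}(x)` for all other `x ∈ S_n`. -/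
theorem D_difference_of_braid
    (n : ℕ) (hn : 2 ≤ n) (T₁ T₂ : List ℕ) (i : ℕ)
    (hi : 1 ≤ i ∧ i ≤ n - 2)
    (hred₁ : IsReducedWordFor n (T₁ ++ [i, i + 1, i] ++ T₂) (w0 n))
    (hred₂ : IsReducedWordFor n (T₁ ++ [i + 1, i, i + 1] ++ T₂) (w0 n))
    (v₁ v₂ : Equiv.Perm (Fin n))
    (hv₁ : v₁ = dem n (T₁ ++ [i] ++ T₂))
    (hv₂ : v₂ = dem n (T₁ ++ [i + 1] ++ T₂)) :
    ∀ x : Equiv.Perm (Fin n),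
      (x = v₁ →
        D n (T₁ ++ [i, i + 1, i] ++ T₂) x
          - D n (T₁ ++ [i + 1, i, i + 1] ++ T₂) x = 1) ∧
      (x = v₂ →
        D n (T₁ ++ [i, i + 1, i] ++ T₂) x
          - D n (T₁ ++ [i + 1, i, i + 1] ++ T₂) x = -1) ∧
      (x ≠ v₁ → x ≠ v₂ →
        D n (T₁ ++ [i, i + 1, i] ++ T₂) x
          = D n (T₁ ++ [i + 1, i, i + 1] ++ T₂) x) := by
  have hi' : 1 ≤ i ∧ i + 1 < n := by omega
  have hne : v₁ ≠ v₂ := by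
    rw [hv₁, hv₂]
    exact v_ne T₁ T₂ i hi' hred₁
  have hN : (T₁ ++ [i, i + 1, i] ++ T₂).length = n * (n - 1) / 2 := by
    rw [hred₁.1.2, hred₁.2, len_w0]
  simp only [List.length_append, List.length_cons, List.length_nil] at hN
  have hA := hred₁.1.1
  have top : ∀ k, k = i ∨ k = i + 1 → ∀ x,
      (wt n (T₁ ++ [k] ++ T₂) x).coeff (n * (n - 1) / 2 - 2) =
        if x = dem n (T₁ ++ [k] ++ T₂) then 1 else 0 := by
    intro k hk x
    have hAk : Alphabet n (T₁ ++ [k] ++ T₂) := by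
      intro l hl
      apply hA
      simp only [List.mem_append, List.mem_cons, List.not_mem_nil, or_false] at hl ⊢
      rcases hk with rfl | rfl <;> tauto
    have := wt_top (T₁ ++ [k] ++ T₂) (fun x => if x = 1 then 1 else 0) 1 0 hAk
      (by intro x k hk; split_ifs <;> simp [Polynomial.coeff_one]; omega)
      (by intro x; split_ifs <;> simp) x
    rw [wt_eq, dem_eq, ← this]
    congr 1
    simp only [List.length_append, List.length_cons, List.length_nil]
    omega
  have key : ∀ x, D n (T₁ ++ [i, i + 1, i] ++ T₂) x - D n (T₁ ++ [i + 1, i, i + 1] ++ T₂) x =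
      (if x = v₁ then 1 else 0) - (if x = v₂ then 1 else 0) := by
    intro x
    have h1 := wt_diff T₂ _ _ _ _
      (braid_step i hi' (T₁.foldl (wtStep n) (fun x => if x = 1 then 1 else 0))) x
    have hw : ∀ B : List ℕ, T₂.foldl (wtStep n) (B.foldl (wtStep n)
        (T₁.foldl (wtStep n) (fun x => if x = 1 then 1 else 0))) = wt n (T₁ ++ B ++ T₂) := by
      intro B
      rw [wt_eq, List.foldl_append, List.foldl_append]
    have h1' : wt n (T₁ ++ [i, i + 1, i] ++ T₂) x - wt n (T₁ ++ [i + 1, i, i + 1] ++ T₂) x =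
        Polynomial.X * (wt n (T₁ ++ [i] ++ T₂) x - wt n (T₁ ++ [i + 1] ++ T₂) x) := by
      rw [← hw, ← hw, ← hw, ← hw]
      exact h1
    unfold D
    rw [← Polynomial.coeff_sub, h1',
      show n * (n - 1) / 2 - 1 = (n * (n - 1) / 2 - 2) + 1 by omega, Polynomial.coeff_X_mul,
      Polynomial.coeff_sub, top i (Or.inl rfl), top (i + 1) (Or.inr rfl), hv₁, hv₂]
  intro x
  have hx := key x
  refine ⟨fun h => ?_, fun h => ?_, fun h h' => ?_⟩
  · rw [hx, if_pos h, if_neg (by rw [h]; exact hne)]; norm_num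
  · rw [hx, if_pos h, if_neg (by rw [h]; exact hne.symm)]; norm_num
  · rw [if_neg h, if_neg h'] at hx
    linarith

end BSDist
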